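/- Let Γ be a group generated by a finite set S, F the free group on S, and π : F → Γ the induced epimorphism. Then Γ is locally stable if and only if the system of equations {r = e : r ∈ ker π} is locally stable in permutations. -/

import Mathlib

open Filter Topology

open scoped Classical

/-- Normalized Hamming metric on `Sym(k)`:
`d_k(σ,τ) = |{i : σ i ≠ τ i}| / k` (which equals `1 - |{i : σ i = τ i}|/k` for `k ≥ 1`). -/
noncomputable def dHam {k : ℕ} (σ τ : Equiv.Perm (Fin k)) : ℝ :=
  ((Finset.univ.filter fun i => σ i ≠ τ i).card : ℝ) / k

/-- `(φ_n)` is an almost-homomorphism. -/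
def IsAlmostHom {Γ : Type*} [Group Γ] (k : ℕ → ℕ)
    (φ : ∀ n, Γ → Equiv.Perm (Fin (k n))) : Prop :=
  ∀ g h : Γ,
    Tendsto (fun n => dHam (φ n g * φ n h) (φ n (g * h))) atTop (𝓝 0)

/-- `(φ_n)` is a partial homomorphism. -/
def IsPartialHom {Γ : Type*} [Group Γ] (k : ℕ → ℕ)
    (φ : ∀ n, Γ → Equiv.Perm (Fin (k n))) : Prop :=
  ∀ g h : Γ, ∀ᶠ n in atTop, φ n (g * h) = φ n g * φ n h

/-- `(φ_n)` is separating. -/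
def IsSeparating {Γ : Type*} [Group Γ] (k : ℕ → ℕ)
    (φ : ∀ n, Γ → Equiv.Perm (Fin (k n))) : Prop :=
  ∀ g : Γ, g ≠ 1 → Tendsto (fun n => dHam (φ n g) 1) atTop (𝓝 1)

/-- `(φ_n)` is a sequence of genuine homomorphisms. -/
def IsHomSeq {Γ : Type*} [Group Γ] (k : ℕ → ℕ)
    (φ : ∀ n, Γ → Equiv.Perm (Fin (k n))) : Prop :=
  ∀ n, ∀ g h : Γ, φ n (g * h) = φ n g * φ n h

/-- `(ψ_n)` is asymptotically close to `(φ_n)`: for every `g`, `d_{k_n}(φ_n g, ψ_n g) → 0`. -/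
def CloseSeq {Γ : Type*} [Group Γ] (k : ℕ → ℕ)
    (φ ψ : ∀ n, Γ → Equiv.Perm (Fin (k n))) : Prop :=
  ∀ g : Γ, Tendsto (fun n => dHam (φ n g) (ψ n g)) atTop (𝓝 0)

/-- `Γ` is locally stable. -/
def IsLocallyStable (Γ : Type*) [Group Γ] : Prop :=
  ∀ (k : ℕ → ℕ), (∀ n, 0 < k n) →
    ∀ φ : ∀ n, Γ → Equiv.Perm (Fin (k n)), IsAlmostHom k φ →
      ∃ ψ : ∀ n, Γ → Equiv.Perm (Fin (k n)), IsPartialHom k ψ ∧ CloseSeq k φ ψ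

/-- `Γ` is weakly locally stable. -/
def IsWeaklyLocallyStable (Γ : Type*) [Group Γ] : Prop :=
  ∀ (k : ℕ → ℕ), (∀ n, 0 < k n) →
    ∀ φ : ∀ n, Γ → Equiv.Perm (Fin (k n)), IsAlmostHom k φ → IsSeparating k φ →
      ∃ ψ : ∀ n, Γ → Equiv.Perm (Fin (k n)), IsPartialHom k ψ ∧ CloseSeq k φ ψ

/-- `Γ` is stable (in permutations). -/
def IsStable (Γ : Type*) [Group Γ] : Prop :=
  ∀ (k : ℕ → ℕ), (∀ n, 0 < k n) →
    ∀ φ : ∀ n, Γ → Equiv.Perm (Fin (k n)), IsAlmostHom k φ →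
      ∃ ψ : ∀ n, Γ → Equiv.Perm (Fin (k n)), IsHomSeq k ψ ∧ CloseSeq k φ ψ

/-- `Γ` is weakly stable. -/
def IsWeaklyStable (Γ : Type*) [Group Γ] : Prop :=
  ∀ (k : ℕ → ℕ), (∀ n, 0 < k n) →
    ∀ φ : ∀ n, Γ → Equiv.Perm (Fin (k n)), IsAlmostHom k φ → IsSeparating k φ →
      ∃ ψ : ∀ n, Γ → Equiv.Perm (Fin (k n)), IsHomSeq k ψ ∧ CloseSeq k φ ψ

/-- `Γ` is sofic: it admits a separating almost-homomorphism. -/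
def IsSofic (Γ : Type*) [Group Γ] : Prop :=
  ∃ (k : ℕ → ℕ), (∀ n, 0 < k n) ∧
    ∃ φ : ∀ n, Γ → Equiv.Perm (Fin (k n)), IsAlmostHom k φ ∧ IsSeparating k φ

/-- `Γ` is LEF: it admits a separating partial homomorphism. -/
def IsLEF (Γ : Type*) [Group Γ] : Prop :=
  ∃ (k : ℕ → ℕ), (∀ n, 0 < k n) ∧
    ∃ φ : ∀ n, Γ → Equiv.Perm (Fin (k n)), IsPartialHom k φ ∧ IsSeparating k φ

/-- The system of equations `{r = e : r ∈ R}` (over the free group on the finite set `ι`)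
is locally stable in permutations. -/
def EqnLocallyStable {ι : Type} [Fintype ι] (R : Set (FreeGroup ι)) : Prop :=
  ∀ ε : ℝ, 0 < ε → ∀ R₀ : Finset (FreeGroup ι), ↑R₀ ⊆ R →
    ∃ δ : ℝ, 0 < δ ∧ ∃ R₁ : Finset (FreeGroup ι), ↑R₁ ⊆ R ∧
      ∀ (k : ℕ) (σ : ι → Equiv.Perm (Fin k)),
        (∀ r ∈ R₁, dHam (FreeGroup.lift σ r) 1 < δ) →
        ∃ τ : ι → Equiv.Perm (Fin k),
          (∀ r ∈ R₀, FreeGroup.lift τ r = 1) ∧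
          ∑ i : ι, dHam (σ i) (τ i) < ε

lemma dHam_nonneg {k : ℕ} (σ τ : Equiv.Perm (Fin k)) : 0 ≤ dHam σ τ := by
  unfold dHam; positivity

lemma dHam_self {k : ℕ} (σ : Equiv.Perm (Fin k)) : dHam σ σ = 0 := by
  simp [dHam]

lemma dHam_comm {k : ℕ} (σ τ : Equiv.Perm (Fin k)) : dHam σ τ = dHam τ σ := by
  simp only [dHam, ne_comm]

lemma dHam_triangle {k : ℕ} (ρ σ τ : Equiv.Perm (Fin k)) :
    dHam ρ τ ≤ dHam ρ σ + dHam σ τ := by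
  simp only [dHam, ← add_div]
  gcongr
  norm_cast
  refine le_trans (Finset.card_le_card fun i hi => ?_) (Finset.card_union_le _ _)
  simp only [Finset.mem_filter, Finset.mem_union, Finset.mem_univ, true_and] at hi ⊢
  by_contra! h
  exact hi (h.1.trans h.2)

lemma dHam_mul_left {k : ℕ} (ρ σ τ : Equiv.Perm (Fin k)) :
    dHam (ρ * σ) (ρ * τ) = dHam σ τ := by
  simp [dHam]

lemma dHam_mul_right {k : ℕ} (ρ σ τ : Equiv.Perm (Fin k)) :
    dHam (σ * ρ) (τ * ρ) = dHam σ τ := by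
  unfold dHam
  congr 2
  refine Finset.card_bij (fun i _ => ρ i) (fun i hi => ?_) (fun _ _ _ _ h => ρ.injective h)
    fun j hj => ⟨ρ⁻¹ j, ?_, by simp⟩
  · rw [Finset.mem_filter_univ] at hi ⊢
    exact hi
  · rw [Finset.mem_filter_univ] at hj ⊢
    simpa using hj

lemma dHam_mul_mul_le {k : ℕ} (a b c d : Equiv.Perm (Fin k)) :
    dHam (a * b) (c * d) ≤ dHam a c + dHam b d := by
  have h := dHam_triangle (a * b) (c * b) (c * d)
  rwa [dHam_mul_right, dHam_mul_left] at h

lemma dHam_inv_inv {k : ℕ} (a b : Equiv.Perm (Fin k)) : dHam a⁻¹ b⁻¹ = dHam a b := by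
  rw [← dHam_mul_left a, ← dHam_mul_right b]
  simp [dHam_comm]

lemma dHam_mul_inv_one {k : ℕ} (a b : Equiv.Perm (Fin k)) : dHam (a * b⁻¹) 1 = dHam a b := by
  rw [← dHam_mul_right b]
  simp

section Asymptotic

variable {k : ℕ → ℕ}

lemma tendsto_dHam_of_le {a b : ∀ n, Equiv.Perm (Fin (k n))} {u : ℕ → ℝ}
    (hu : Tendsto u atTop (𝓝 0)) (h : ∀ n, dHam (a n) (b n) ≤ u n) :
    Tendsto (fun n => dHam (a n) (b n)) atTop (𝓝 0) :=
  squeeze_zero (fun _ => dHam_nonneg _ _) h hu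

lemma tendsto_dHam_trans {a b c : ∀ n, Equiv.Perm (Fin (k n))}
    (hab : Tendsto (fun n => dHam (a n) (b n)) atTop (𝓝 0))
    (hbc : Tendsto (fun n => dHam (b n) (c n)) atTop (𝓝 0)) :
    Tendsto (fun n => dHam (a n) (c n)) atTop (𝓝 0) :=
  tendsto_dHam_of_le (by simpa using hab.add hbc) fun _ => dHam_triangle _ _ _

lemma tendsto_dHam_mul {a b c d : ∀ n, Equiv.Perm (Fin (k n))}
    (hac : Tendsto (fun n => dHam (a n) (c n)) atTop (𝓝 0))
    (hbd : Tendsto (fun n => dHam (b n) (d n)) atTop (𝓝 0)) :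
    Tendsto (fun n => dHam (a n * b n) (c n * d n)) atTop (𝓝 0) :=
  tendsto_dHam_of_le (by simpa using hac.add hbd) fun _ => dHam_mul_mul_le _ _ _ _

lemma tendsto_dHam_symm {a b : ∀ n, Equiv.Perm (Fin (k n))}
    (hab : Tendsto (fun n => dHam (a n) (b n)) atTop (𝓝 0)) :
    Tendsto (fun n => dHam (b n) (a n)) atTop (𝓝 0) := by
  simpa only [dHam_comm] using hab

lemma tendsto_dHam_lift {ι : Type*} {σ τ : ∀ n, ι → Equiv.Perm (Fin (k n))}
    (h : ∀ i, Tendsto (fun n => dHam (σ n i) (τ n i)) atTop (𝓝 0)) (w : FreeGroup ι) :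
    Tendsto (fun n => dHam (FreeGroup.lift (σ n) w) (FreeGroup.lift (τ n) w)) atTop (𝓝 0) := by
  induction w using FreeGroup.induction_on with
  | C1 => simp [dHam_self]
  | of i => simpa using h i
  | inv_of i ih => simpa [dHam_inv_inv] using ih
  | mul x y hx hy =>
    simp only [map_mul]
    exact tendsto_dHam_mul hx hy

variable {Γ : Type*} [Group Γ] {φ ψ : ∀ n, Γ → Equiv.Perm (Fin (k n))}

lemma IsAlmostHom.tendsto_one (h : IsAlmostHom k φ) :
    Tendsto (fun n => dHam (φ n 1) 1) atTop (𝓝 0) := by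
  refine (h 1 1).congr fun n => ?_
  rw [← dHam_mul_left (φ n 1) (φ n 1) 1]
  simp

lemma IsAlmostHom.tendsto_inv (h : IsAlmostHom k φ) (g : Γ) :
    Tendsto (fun n => dHam (φ n g)⁻¹ (φ n g⁻¹)) atTop (𝓝 0) := by
  have h₁ := h g g⁻¹
  rw [mul_inv_cancel] at h₁
  refine (tendsto_dHam_symm (tendsto_dHam_trans h₁ h.tendsto_one)).congr fun n => ?_
  rw [← dHam_mul_left (φ n g) (φ n g)⁻¹]
  simp

lemma IsAlmostHom.tendsto_lift (h : IsAlmostHom k φ) {ι : Type*} (f : ι → Γ)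
    (w : FreeGroup ι) :
    Tendsto (fun n => dHam (FreeGroup.lift (fun i => φ n (f i)) w) (φ n (FreeGroup.lift f w)))
      atTop (𝓝 0) := by
  induction w using FreeGroup.induction_on with
  | C1 => simpa using tendsto_dHam_symm h.tendsto_one
  | of i => simp [dHam_self]
  | inv_of i => simpa using h.tendsto_inv (f i)
  | mul x y hx hy =>
    simp only [map_mul]
    exact tendsto_dHam_trans (tendsto_dHam_mul hx hy) (h _ _)

lemma IsPartialHom.eventually_one (h : IsPartialHom k ψ) : ∀ᶠ n in atTop, ψ n 1 = 1 := by
  filter_upwards [h 1 1] with n hn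
  simpa using hn

lemma IsPartialHom.eventually_lift (h : IsPartialHom k ψ) {ι : Type*} (f : ι → Γ)
    (w : FreeGroup ι) :
    ∀ᶠ n in atTop, FreeGroup.lift (fun i => ψ n (f i)) w = ψ n (FreeGroup.lift f w) := by
  induction w using FreeGroup.induction_on with
  | C1 => simpa [eq_comm] using h.eventually_one
  | of i => simp
  | inv_of i =>
    filter_upwards [h (f i) (f i)⁻¹, h.eventually_one] with n hn h₁
    rw [mul_inv_cancel, h₁] at hn
    simpa using inv_eq_of_mul_eq_one_right hn.symm
  | mul x y hx hy =>
    filter_upwards [hx, hy, h (FreeGroup.lift f x) (FreeGroup.lift f y)] with n hx hy hxy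
    simp only [map_mul, hx, hy, hxy]

end Asymptotic

/-- Diagonal selection: if each of countably many conditions, jointly with its predecessors, is
eventually satisfiable, then a single sequence eventually satisfies all of them. -/
lemma exists_seq_forall_eventually {T : ℕ → Type*} [∀ n, Nonempty (T n)]
    {P : ℕ → ∀ n, T n → Prop} (h : ∀ m, ∀ᶠ n in atTop, ∃ t, ∀ j ≤ m, P j n t) :
    ∃ t : ∀ n, T n, ∀ m, ∀ᶠ n in atTop, P m n (t n) := by
  have key : ∀ n, ∃ t : T n, ∀ m ≤ n, (∃ t', ∀ j ≤ m, P j n t') → P m n t := by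
    intro n
    by_cases hn : ∃ m ≤ n, ∃ t', ∀ j ≤ m, P j n t'
    · obtain ⟨m₀, hm₀, hP₀⟩ := hn
      obtain ⟨t, ht⟩ := Nat.findGreatest_spec (P := fun m => ∃ t', ∀ j ≤ m, P j n t') hm₀ hP₀
      exact ⟨t, fun m hm hP => ht m (Nat.le_findGreatest hm hP)⟩
    · exact ⟨Classical.arbitrary _, fun m hm hP => absurd ⟨m, hm, hP⟩ hn⟩
  choose t ht using key
  refine ⟨t, fun m => ?_⟩
  filter_upwards [h m, eventually_ge_atTop m] with n hn hmn
  exact ht n m hmn hn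

section Presentation

variable {ι : Type} [Fintype ι] {Γ : Type*} [Group Γ] {f : ι → Γ}

lemma EqnLocallyStable.isLocallyStable (hf : Function.Surjective (FreeGroup.lift f))
    (h : EqnLocallyStable ((FreeGroup.lift f).ker : Set (FreeGroup ι))) :
    IsLocallyStable Γ := by
  intro k _ φ hφ
  obtain ⟨e, he⟩ := exists_surjective_nat (FreeGroup ι)
  obtain ⟨τ, hτ⟩ : ∃ τ : ∀ n, ι → Equiv.Perm (Fin (k n)), ∀ m, ∀ᶠ n in atTop,
      (FreeGroup.lift f (e m) = 1 → FreeGroup.lift (τ n) (e m) = 1) ∧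
        ∑ i, dHam (φ n (f i)) (τ n i) < 1 / ((m : ℝ) + 1) := by
    refine exists_seq_forall_eventually (P := fun m n (τ : ι → Equiv.Perm (Fin (k n))) =>
      (FreeGroup.lift f (e m) = 1 → FreeGroup.lift τ (e m) = 1) ∧
        ∑ i, dHam (φ n (f i)) (τ i) < 1 / ((m : ℝ) + 1)) fun m => ?_
    obtain ⟨δ, hδ, R₁, hR₁, H⟩ := h (1 / ((m : ℝ) + 1)) (by positivity)
      (((Finset.range (m + 1)).image e).filter fun r => FreeGroup.lift f r = 1)
      (by intro r hr; simpa using (Finset.mem_filter.1 hr).2)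
    have hev : ∀ᶠ n in atTop, ∀ r ∈ R₁,
        dHam (FreeGroup.lift (fun i => φ n (f i)) r) 1 < δ := by
      refine (R₁.eventually_all).2 fun r hr => ?_
      have hr1 : FreeGroup.lift f r = 1 := by simpa using hR₁ hr
      have h₁ := hφ.tendsto_lift f r
      rw [hr1] at h₁
      exact (tendsto_dHam_trans h₁ hφ.tendsto_one).eventually_lt_const hδ
    filter_upwards [hev] with n hn
    obtain ⟨τ, hτ, hlt⟩ := H (k n) _ hn
    refine ⟨τ, fun j hj => ⟨fun hej => hτ _ ?_, hlt.trans_le (by gcongr)⟩⟩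
    exact Finset.mem_filter.2 ⟨Finset.mem_image_of_mem _ (by simpa [Nat.lt_succ_iff] using hj), hej⟩
  have hclose : ∀ i, Tendsto (fun n => dHam (φ n (f i)) (τ n i)) atTop (𝓝 0) := by
    intro i
    refine (tendsto_order.2 ⟨fun a ha => ?_, fun a ha => ?_⟩)
    · exact Eventually.of_forall fun n => ha.trans_le (dHam_nonneg _ _)
    · obtain ⟨m, hm⟩ := exists_nat_one_div_lt ha
      filter_upwards [hτ m] with n hn
      exact (Finset.single_le_sum (f := fun i => dHam (φ n (f i)) (τ n i))
        (fun _ _ => dHam_nonneg _ _) (Finset.mem_univ i)).trans_lt (hn.2.trans hm)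
  choose s hs using hf
  refine ⟨fun n g => FreeGroup.lift (τ n) (s g), fun g g' => ?_, fun g => ?_⟩
  · obtain ⟨m, hm⟩ := he (s (g * g') * (s g * s g')⁻¹)
    filter_upwards [hτ m] with n hn
    have h₁ := hn.1 (by simp [hm, hs])
    rw [hm, map_mul, map_inv, mul_inv_eq_one] at h₁
    rw [h₁, map_mul]
  · have h₁ := tendsto_dHam_symm (hφ.tendsto_lift f (s g))
    rw [hs] at h₁
    exact tendsto_dHam_trans h₁ (tendsto_dHam_lift hclose (s g))

lemma IsLocallyStable.eqnLocallyStable (hf : Function.Surjective (FreeGroup.lift f))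
    (h : IsLocallyStable Γ) :
    EqnLocallyStable ((FreeGroup.lift f).ker : Set (FreeGroup ι)) := by
  intro ε hε R₀ hR₀
  by_contra! hcon
  obtain ⟨e, he⟩ := exists_surjective_nat (FreeGroup ι)
  have hcex : ∀ n : ℕ, ∃ (k : ℕ) (σ : ι → Equiv.Perm (Fin k)),
      (∀ j ≤ n, FreeGroup.lift f (e j) = 1 →
        dHam (FreeGroup.lift σ (e j)) 1 < 1 / ((n : ℝ) + 1)) ∧
      ∀ τ : ι → Equiv.Perm (Fin k), (∀ r ∈ R₀, FreeGroup.lift τ r = 1) →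
        ε ≤ ∑ i, dHam (σ i) (τ i) := by
    intro n
    obtain ⟨k, σ, hσ, H⟩ := hcon (1 / ((n : ℝ) + 1)) (by positivity)
      (((Finset.range (n + 1)).image e).filter fun r => FreeGroup.lift f r = 1)
      (by intro r hr; simpa using (Finset.mem_filter.1 hr).2)
    refine ⟨k, σ, fun j hj hej => hσ _ ?_, H⟩
    exact Finset.mem_filter.2 ⟨Finset.mem_image_of_mem _ (by simpa [Nat.lt_succ_iff] using hj), hej⟩
  choose k σ hσ H using hcex
  have hk : ∀ n, 0 < k n := by
    intro n
    by_contra! hn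
    have hn' : k n = 0 := by omega
    have : Subsingleton (Equiv.Perm (Fin (k n))) := by rw [hn']; infer_instance
    have h₁ := H n (σ n) fun r _ => Subsingleton.elim _ _
    simp only [dHam_self, Finset.sum_const_zero] at h₁
    linarith
  have hker : ∀ w w', FreeGroup.lift f w = FreeGroup.lift f w' →
      Tendsto (fun n => dHam (FreeGroup.lift (σ n) w) (FreeGroup.lift (σ n) w')) atTop (𝓝 0) := by
    intro w w' hw
    obtain ⟨m, hm⟩ := he (w * w'⁻¹)
    refine squeeze_zero' (Eventually.of_forall fun _ => dHam_nonneg _ _) ?_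
      tendsto_one_div_add_atTop_nhds_zero_nat
    filter_upwards [eventually_ge_atTop m] with n hn
    have h₁ := hσ n m hn (by simp [hm, hw])
    rw [hm, map_mul, map_inv, dHam_mul_inv_one] at h₁
    exact h₁.le
  choose s hs using hf
  obtain ⟨ψ, hψ, hclose⟩ := h k hk (fun n g => FreeGroup.lift (σ n) (s g)) fun g g' => by
    simpa using hker (s g * s g') (s (g * g')) (by simp [hs])
  have hsol : ∀ᶠ n in atTop, ∀ r ∈ R₀, FreeGroup.lift (fun i => ψ n (f i)) r = 1 := by
    refine (R₀.eventually_all).2 fun r hr => ?_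
    have hr1 : FreeGroup.lift f r = 1 := by simpa using hR₀ hr
    filter_upwards [hψ.eventually_lift f r, hψ.eventually_one] with n hn h₁
    rw [hn, hr1, h₁]
  have hsum : Tendsto (fun n => ∑ i, dHam (σ n i) (ψ n (f i))) atTop (𝓝 0) := by
    have h₁ := tendsto_finsetSum Finset.univ fun i _ =>
      tendsto_dHam_trans (hker (FreeGroup.of i) (s (f i)) (by simp [hs])) (hclose (f i))
    simpa using h₁
  obtain ⟨n, hn, hlt⟩ := (hsol.and (hsum.eventually_lt_const hε)).exists
  exact (H n _ hn).not_gt hlt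

end Presentation

/-- `Γ` (generated by the finite set `S`, with `π` the epimorphism from the free group
on `S`) is locally stable iff the system of equations `{r = e : r ∈ ker π}` is locally
stable in permutations. -/
theorem locallyStable_iff_eqnLocallyStable (Γ : Type) [Group Γ] (S : Finset Γ)
    (hS : Subgroup.closure (S : Set Γ) = ⊤) :
    IsLocallyStable Γ ↔
      EqnLocallyStable
        (((FreeGroup.lift fun s : ↥S => (s : Γ)).ker : Subgroup (FreeGroup ↥S)) :
          Set (FreeGroup ↥S)) := by
  have hf : Function.Surjective (FreeGroup.lift fun s : ↥S => (s : Γ)) := by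
    rw [← MonoidHom.range_eq_top, FreeGroup.range_lift_eq_closure, Subtype.range_coe_subtype]
    exact hS
  exact ⟨fun h => h.eqnLocallyStable hf, fun h => h.isLocallyStable hf⟩
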